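/- arXiv:1102.2207 — 7 statements merged into one kernel-verified Lean document; each statement's English description precedes it below -/
import Mathlib

section
/- For every k ∈ {0,…,n−1} and every α ∈ [α_k, α_{k+1}) (taking the last interval to be [α_{n−1}, 1]), the weight vector w_α is nonincreasing in the index and strictly positive: w_α(1) ≥ w_α(2) ≥ … ≥ w_α(n) > 0. -/
/-- The breakpoints `α_k`: `α_0 = 0` and
`α_{k+1} = α_k + (1−α_k)·(p (n−k−1) − p (n−k)) / ((1/(k+1))·∑_{i=1}^{n−k−1} p i + p (n−k−1))`. -/
noncomputable def alphaB (n : ℕ) (p : ℕ → ℝ) : ℕ → ℝ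
  | 0 => 0
  | k + 1 =>
      alphaB n p k + (1 - alphaB n p k) * (p (n - k - 1) - p (n - k)) /
        ((1 / ((k : ℝ) + 1)) * (∑ i ∈ Finset.Icc 1 (n - k - 1), p i) + p (n - k - 1))

/-- The weight vector on the interval `[α_k, α_{k+1})`:
`w_α(i) = (1−α)·p i` for `1 ≤ i ≤ n−k−1` and
`w_α(i) = (α + (1−α)·∑_{j=n−k}^{n} p j)/(k+1)` for `n−k ≤ i ≤ n`. -/
noncomputable def wgt (n k : ℕ) (p : ℕ → ℝ) (α : ℝ) (i : ℕ) : ℝ :=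
  if i ≤ n - k - 1 then (1 - α) * p i
  else (α + (1 - α) * ∑ j ∈ Finset.Icc (n - k) n, p j) / ((k : ℝ) + 1)

/-- The closed form `1 − α_k = 1 / (∑_{i ≤ n−k−1} p i + (k+1)·p (n−k))`. -/
theorem one_sub_alphaB_mul (n : ℕ) (p : ℕ → ℝ)
    (hpos : ∀ i, 1 ≤ i → i ≤ n → 0 < p i)
    (hsum : ∑ i ∈ Finset.Icc 1 n, p i = 1) (k : ℕ) (hk : k + 1 ≤ n) :
    (1 - alphaB n p k) *
      (∑ i ∈ Finset.Icc 1 (n - k - 1), p i + ((k : ℝ) + 1) * p (n - k)) = 1 := by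
  induction k with
  | zero =>
    obtain ⟨m, rfl⟩ : ∃ m, n = m + 1 := ⟨n - 1, by omega⟩
    rw [Finset.sum_Icc_succ_top (by omega)] at hsum
    simpa [alphaB] using hsum
  | succ k ih =>
    obtain ⟨m, rfl⟩ : ∃ m, n = m + 1 + (k + 1) := ⟨n - k - 2, by omega⟩
    have ih := ih (by omega)
    have e1 : m + 1 + (k + 1) - k - 1 = m + 1 := by omega
    have e2 : m + 1 + (k + 1) - k = m + 2 := by omega
    have e3 : m + 1 + (k + 1) - (k + 1) - 1 = m := by omega
    have e4 : m + 1 + (k + 1) - (k + 1) = m + 1 := by omega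
    rw [alphaB, e1, e2, e3, e4]
    rw [e1, e2] at ih
    have hS : 0 ≤ ∑ i ∈ Finset.Icc 1 m, p i := Finset.sum_nonneg fun i hi => by
      rw [Finset.mem_Icc] at hi
      exact (hpos i hi.1 (by omega)).le
    have hp := hpos (m + 1) (by omega) (by omega)
    rw [Finset.sum_Icc_succ_top (by omega)] at ih ⊢
    set S := ∑ i ∈ Finset.Icc 1 m, p i
    set a := alphaB (m + 1 + (k + 1)) p k
    have hD : S + p (m + 1) + ((k : ℝ) + 1) * p (m + 1) ≠ 0 := by positivity
    have hk1 : (k : ℝ) + 1 ≠ 0 := by positivity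
    have hfrac : 1 / ((k : ℝ) + 1) * (S + p (m + 1)) + p (m + 1) =
        (S + p (m + 1) + ((k : ℝ) + 1) * p (m + 1)) / ((k : ℝ) + 1) := by
      field_simp
    rw [hfrac]
    push_cast
    field_simp
    linear_combination (S + p (m + 1) + ((k : ℝ) + 1) * p (m + 1)) * ih

/-- For every `k ∈ {0,…,n−1}` and every `α ∈ [α_k, α_{k+1})`
(the last interval being `[α_{n−1}, 1]`), the weight vector `w_α` is nonincreasing
in the index and strictly positive: `w_α(1) ≥ w_α(2) ≥ … ≥ w_α(n) > 0`. -/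
theorem weights_nonincreasing_and_positive
    (n : ℕ) (hn : 2 ≤ n) (p : ℕ → ℝ)
    (hpos : ∀ i, 1 ≤ i → i ≤ n → 0 < p i)
    (hmono : ∀ i j, 1 ≤ i → i ≤ j → j ≤ n → p j ≤ p i)
    (hsum : ∑ i ∈ Finset.Icc 1 n, p i = 1)
    (k : ℕ) (hk : k ≤ n - 1) (α : ℝ)
    (hα1 : alphaB n p k ≤ α)
    (hα2 : if k < n - 1 then α < alphaB n p (k + 1) else α ≤ 1) :
    (∀ i j, 1 ≤ i → i ≤ j → j ≤ n → wgt n k p α j ≤ wgt n k p α i) ∧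
      0 < wgt n k p α n := by
  set b := 1 - α with hb
  have hk' : k + 1 ≤ n := by omega
  have hinv := one_sub_alphaB_mul n p hpos hsum k hk'
  have hpk : 0 < p (n - k) := hpos _ (by omega) (by omega)
  have hS : 0 ≤ ∑ i ∈ Finset.Icc 1 (n - k - 1), p i := Finset.sum_nonneg fun i hi => by
    rw [Finset.mem_Icc] at hi
    exact (hpos i hi.1 (by omega)).le
  have hk1 : (0 : ℝ) < (k : ℝ) + 1 := by positivity
  have htail : ∑ j ∈ Finset.Icc (n - k) n, p j =
      1 - ∑ i ∈ Finset.Icc 1 (n - k - 1), p i := by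
    have hIoc := Finset.sum_Ioc_consecutive p (Nat.zero_le (n - k - 1)) (by omega : n - k - 1 ≤ n)
    simp only [← Finset.Icc_add_one_left_eq_Ioc, zero_add] at hIoc
    rw [show n - k - 1 + 1 = n - k by omega] at hIoc
    linarith
  have hbpos : 0 ≤ b ∧ (1 ≤ n - k - 1 →
      1 ≤ b * (∑ i ∈ Finset.Icc 1 (n - k - 1), p i + ((k : ℝ) + 1) * p (n - k - 1))) := by
    by_cases hlt : k < n - 1
    · rw [if_pos hlt] at hα2
      have hinv' := one_sub_alphaB_mul n p hpos hsum (k + 1) (by omega)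
      obtain ⟨m, hm⟩ : ∃ m, n - k - 1 = m + 1 := ⟨n - k - 2, by omega⟩
      have hpm : 0 < p (m + 1) := hpos _ (by omega) (by omega)
      rw [show n - (k + 1) - 1 = m by omega, show n - (k + 1) = m + 1 by omega] at hinv'
      rw [hm, Finset.sum_Icc_succ_top (by omega)] at hS ⊢
      push_cast at hinv'
      have hD : 0 < ∑ i ∈ Finset.Icc 1 m, p i + p (m + 1) + ((k : ℝ) + 1) * p (m + 1) := by
        have hkp := mul_pos hk1 hpm
        linarith
      have hinv'' : (1 - alphaB n p (k + 1)) *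
          (∑ i ∈ Finset.Icc 1 m, p i + p (m + 1) + ((k : ℝ) + 1) * p (m + 1)) = 1 := by
        linear_combination hinv'
      have hle : 1 - alphaB n p (k + 1) ≤ b := by linarith
      have hmul := mul_le_mul_of_nonneg_right hle hD.le
      rw [hinv''] at hmul
      exact ⟨(pos_of_mul_pos_left (zero_lt_one.trans_le hmul) hD.le).le, fun _ => hmul⟩
    · rw [if_neg hlt] at hα2
      exact ⟨by linarith, fun h => by omega⟩
  obtain ⟨hb0, hbD⟩ := hbpos
  refine ⟨fun i j hi hij hj => ?_, ?_⟩
  · unfold wgt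
    rw [htail, ← hb]
    by_cases hjm : j ≤ n - k - 1
    · rw [if_pos hjm, if_pos (hij.trans hjm)]
      exact mul_le_mul_of_nonneg_left (hmono i j hi hij hj) hb0
    · rw [if_neg hjm]
      by_cases him : i ≤ n - k - 1
      · rw [if_pos him, div_le_iff₀ hk1]
        have h1 := hbD (hi.trans him)
        have h2 := mul_le_mul_of_nonneg_left (hmono i (n - k - 1) hi him (by omega))
          (mul_nonneg hb0 hk1.le)
        linarith
      · rw [if_neg him]
  · unfold wgt
    rw [htail, ← hb, if_neg (by omega)]
    refine div_pos ?_ hk1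
    have hle : b ≤ 1 - alphaB n p k := by linarith
    have h1 := mul_le_mul_of_nonneg_right hle hS
    have h0 : 0 < 1 - alphaB n p k :=
      pos_of_mul_pos_left (by rw [hinv]; exact one_pos) (by positivity)
    have h2 : 0 < (1 - alphaB n p k) * (((k : ℝ) + 1) * p (n - k)) := by positivity
    linarith
end

section
/- Within each interval the weights for symbols outside the merged set strictly decrease in α while the common minimal weight strictly increases: for k ∈ {0,…,n−2} and α, α′ with α_k ≤ α < α′ < α_{k+1}, one has w_{α′}(i) < w_α(i) for every 1 ≤ i ≤ n−k−1 and w_α(i) < w_{α′}(i) for every n−k ≤ i ≤ n. -/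
/-- Within each interval, the weights of symbols outside the merged set
strictly decrease in `α` while the common minimal weight strictly increases: for
`k ∈ {0,…,n−2}` and `α_k ≤ α < α′ < α_{k+1}`, `w_{α′}(i) < w_α(i)` for every
`1 ≤ i ≤ n−k−1`, and `w_α(i) < w_{α′}(i)` for every `n−k ≤ i ≤ n`. -/
theorem weights_monotone_in_alpha
    (n : ℕ) (hn : 2 ≤ n) (p : ℕ → ℝ)
    (hpos : ∀ i, 1 ≤ i → i ≤ n → 0 < p i)
    (hmono : ∀ i j, 1 ≤ i → i ≤ j → j ≤ n → p j ≤ p i)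
    (hsum : ∑ i ∈ Finset.Icc 1 n, p i = 1)
    (k : ℕ) (hk : k ≤ n - 2) (α α' : ℝ)
    (hα1 : alphaB n p k ≤ α) (hαα' : α < α') (hα2 : α' < alphaB n p (k + 1)) :
    (∀ i, 1 ≤ i → i ≤ n - k - 1 → wgt n k p α' i < wgt n k p α i) ∧
      (∀ i, n - k ≤ i → i ≤ n → wgt n k p α i < wgt n k p α' i) := by
  constructor
  · intro i hi1 hi2
    have hp := hpos i hi1 (by omega)
    simp only [wgt, if_pos hi2]
    gcongr
  · intro i hi1 hi2
    have hnot : ¬ i ≤ n - k - 1 := by omega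
    have hS : ∑ j ∈ Finset.Icc (n - k) n, p j < 1 := by
      rw [← hsum]
      refine Finset.sum_lt_sum_of_subset (i := 1) (Finset.Icc_subset_Icc (by omega) le_rfl)
        (by simp; omega) (by simp; omega) (hpos 1 le_rfl (by omega)) fun j hj _ => ?_
      rw [Finset.mem_Icc] at hj
      exact (hpos j hj.1 hj.2).le
    simp only [wgt, if_neg hnot]
    gcongr ?_ / _
    nlinarith [mul_pos (sub_pos.mpr hαα') (sub_pos.mpr hS)]
end

section
/- For every k ∈ {0,…,n−1} and every α ∈ [α_k, α_{k+1}) (taking the last interval to be [α_{n−1}, 1]), the set of indices at which w_α attains its minimum value min_{1≤i≤n} w_α(i) is exactly {n−k, n−k+1, …, n}; in particular this set has cardinality k+1, and the common minimal value equals (α + (1−α)·∑_{j=n−k}^{n} p_j)/(k+1). -/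
/-- Closed form of the breakpoints: `1 − α_k` is the inverse of `k · p_{n−k} + ∑_{i ≤ n−k} p_i`. -/
theorem one_sub_alphaB_mul_eq_one (n : ℕ) (p : ℕ → ℝ)
    (hpos : ∀ i, 1 ≤ i → i ≤ n → 0 < p i)
    (hsum : ∑ i ∈ Finset.Icc 1 n, p i = 1) (k : ℕ) (hk : k < n) :
    (1 - alphaB n p k) * (k * p (n - k) + ∑ i ∈ Finset.Icc 1 (n - k), p i) = 1 := by
  induction k with
  | zero => simp [alphaB, hsum]
  | succ k ih =>
    have ih := ih (by omega)
    obtain ⟨m, rfl⟩ : ∃ m, n = m + k + 1 := ⟨n - k - 1, by omega⟩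
    have h₁ : m + k + 1 - k = m + 1 := by omega
    have h₂ : m + k + 1 - (k + 1) = m := by omega
    rw [h₁, Finset.sum_Icc_succ_top (by omega)] at ih
    simp only [alphaB, h₁, h₂, Nat.add_sub_cancel]
    have hT : 0 ≤ ∑ i ∈ Finset.Icc 1 m, p i := Finset.sum_nonneg fun i hi => by
      rw [Finset.mem_Icc] at hi
      exact (hpos i hi.1 (by omega)).le
    have hp : 0 < p m := hpos m (by omega) (by omega)
    generalize ∑ i ∈ Finset.Icc 1 m, p i = T at *
    have hD : 1 / ((k : ℝ) + 1) * T + p m ≠ 0 := by positivity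
    have hD' : T + ((k : ℝ) + 1) * p m ≠ 0 := by positivity
    push_cast
    field_simp
    linear_combination (T + ((k : ℝ) + 1) * p m) * ih

/-- Below the next breakpoint, the unmodified weights stay strictly above the common weight. -/
theorem common_weight_lt (n : ℕ) (p : ℕ → ℝ)
    (hpos : ∀ i, 1 ≤ i → i ≤ n → 0 < p i)
    (hmono : ∀ i j, 1 ≤ i → i ≤ j → j ≤ n → p j ≤ p i)
    (hsum : ∑ i ∈ Finset.Icc 1 n, p i = 1) (k : ℕ) (hk : k + 1 < n) (α : ℝ)
    (hα : α < alphaB n p (k + 1)) (i : ℕ) (hi : 1 ≤ i) (hi' : i ≤ n - k - 1) :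
    (α + (1 - α) * ∑ j ∈ Finset.Icc (n - k) n, p j) / ((k : ℝ) + 1) < (1 - α) * p i := by
  have key := one_sub_alphaB_mul_eq_one n p hpos hsum (k + 1) hk
  obtain ⟨m, rfl⟩ : ∃ m, n = m + k + 1 := ⟨n - k - 1, by omega⟩
  have h₁ : m + k + 1 - k = m + 1 := by omega
  have h₂ : m + k + 1 - (k + 1) = m := by omega
  have him : i ≤ m := by omega
  rw [h₂] at key
  rw [h₁]
  have hsplit : ∑ j ∈ Finset.Icc 1 m, p j + ∑ j ∈ Finset.Icc (m + 1) (m + k + 1), p j = 1 := by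
    rw [← hsum]
    simpa only [← Finset.Ico_add_one_right_eq_Icc] using
      Finset.sum_Ico_consecutive p (m := 1) (n := m + 1) (k := m + k + 1 + 1)
        (by omega) (by omega)
  have hT : 0 ≤ ∑ i ∈ Finset.Icc 1 m, p i := Finset.sum_nonneg fun i hi => by
    rw [Finset.mem_Icc] at hi
    exact (hpos i hi.1 (by omega)).le
  have hp : 0 < p m := hpos m (by omega) (by omega)
  have hpi : p m ≤ p i := hmono i m hi him (by omega)
  push_cast at key
  generalize ∑ i ∈ Finset.Icc 1 m, p i = T at *
  have hD : 0 < ((k : ℝ) + 1) * p m + T := by positivity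
  have hβ : 0 < 1 - alphaB (m + k + 1) p (k + 1) :=
    pos_of_mul_pos_left (one_pos.trans_eq key.symm) hD.le
  have hlt : 1 < (1 - α) * (((k : ℝ) + 1) * p m + T) :=
    key.symm.trans_lt (mul_lt_mul_of_pos_right (by linarith) hD)
  have hle : (1 - α) * p m ≤ (1 - α) * p i := by
    have : 0 ≤ 1 - α := by linarith
    gcongr
  refine lt_of_lt_of_le ?_ hle
  rw [div_lt_iff₀ (by positivity), eq_sub_of_add_eq' hsplit]
  linarith

open scoped Classical in
/-- For every `k ∈ {0,…,n−1}` and every `α ∈ [α_k, α_{k+1})` (last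
interval `[α_{n−1}, 1]`), the set of indices at which `w_α` attains its minimum over
`{1,…,n}` is exactly `{n−k, …, n}`; this set has cardinality `k+1`, and the common
minimal value equals `(α + (1−α)·∑_{j=n−k}^{n} p j)/(k+1)`. -/
theorem min_weight_set_eq_Icc
    (n : ℕ) (hn : 2 ≤ n) (p : ℕ → ℝ)
    (hpos : ∀ i, 1 ≤ i → i ≤ n → 0 < p i)
    (hmono : ∀ i j, 1 ≤ i → i ≤ j → j ≤ n → p j ≤ p i)
    (hsum : ∑ i ∈ Finset.Icc 1 n, p i = 1)
    (k : ℕ) (hk : k ≤ n - 1) (α : ℝ)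
    (hα1 : alphaB n p k ≤ α)
    (hα2 : if k < n - 1 then α < alphaB n p (k + 1) else α ≤ 1) :
    (Finset.Icc 1 n).filter
        (fun i => wgt n k p α i =
          (Finset.Icc 1 n).inf' (Finset.nonempty_Icc.mpr (by omega)) (wgt n k p α)) =
      Finset.Icc (n - k) n ∧
    ((Finset.Icc 1 n).filter
        (fun i => wgt n k p α i =
          (Finset.Icc 1 n).inf' (Finset.nonempty_Icc.mpr (by omega)) (wgt n k p α))).card
      = k + 1 ∧
    (Finset.Icc 1 n).inf' (Finset.nonempty_Icc.mpr (by omega)) (wgt n k p α) =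
      (α + (1 - α) * ∑ j ∈ Finset.Icc (n - k) n, p j) / ((k : ℝ) + 1) := by
  have hcomm : ∀ i ∈ Finset.Icc (n - k) n, wgt n k p α i =
      (α + (1 - α) * ∑ j ∈ Finset.Icc (n - k) n, p j) / ((k : ℝ) + 1) := fun i hi => by
    rw [Finset.mem_Icc] at hi
    exact if_neg (by omega)
  have hlt : ∀ i, 1 ≤ i → i < n - k →
      (α + (1 - α) * ∑ j ∈ Finset.Icc (n - k) n, p j) / ((k : ℝ) + 1) < wgt n k p α i :=
    fun i hi hi' => by
      rw [if_pos (by omega)] at hα2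
      rw [wgt, if_pos (by omega)]
      exact common_weight_lt n p hpos hmono hsum k (by omega) α hα2 i hi (by omega)
  have hmin : (Finset.Icc 1 n).inf' (Finset.nonempty_Icc.mpr (by omega)) (wgt n k p α) =
      (α + (1 - α) * ∑ j ∈ Finset.Icc (n - k) n, p j) / ((k : ℝ) + 1) := by
    apply le_antisymm
    · rw [← hcomm n (Finset.mem_Icc.mpr ⟨by omega, le_rfl⟩)]
      exact Finset.inf'_le _ (Finset.mem_Icc.mpr ⟨by omega, le_rfl⟩)
    · refine Finset.le_inf' _ _ fun i hi => ?_
      rw [Finset.mem_Icc] at hi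
      rcases lt_or_ge i (n - k) with h | h
      · exact (hlt i hi.1 h).le
      · exact (hcomm i (Finset.mem_Icc.mpr ⟨h, hi.2⟩)).ge
  have hset : (Finset.Icc 1 n).filter (fun i => wgt n k p α i =
      (Finset.Icc 1 n).inf' (Finset.nonempty_Icc.mpr (by omega)) (wgt n k p α)) =
      Finset.Icc (n - k) n := by
    ext i
    rw [hmin, Finset.mem_filter]
    constructor
    · rintro ⟨hi, h⟩
      rw [Finset.mem_Icc] at hi ⊢
      exact ⟨not_lt.mp fun h' => (hlt i hi.1 h').ne' h, hi.2⟩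
    · intro hi
      refine ⟨?_, hcomm i hi⟩
      rw [Finset.mem_Icc] at hi ⊢
      omega
  refine ⟨hset, ?_, hmin⟩
  rw [hset, Nat.card_Icc]
  omega
end

section
/- The breakpoints form a nondecreasing sequence contained in [0,1): 0 = α_0 ≤ α_1 ≤ … ≤ α_{n−1} < 1; moreover α_{k+1} > α_k whenever p_{n−k−1} > p_{n−k}. -/
/-- The denominator in the recursion for `alphaB` strictly exceeds the numerator's difference. -/
theorem sub_lt_alphaB_denom (n : ℕ) (p : ℕ → ℝ)
    (hpos : ∀ i, 1 ≤ i → i ≤ n → 0 < p i) (k : ℕ) (hk : k + 2 ≤ n) :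
    p (n - k - 1) - p (n - k) <
      (1 / ((k : ℝ) + 1)) * (∑ i ∈ Finset.Icc 1 (n - k - 1), p i) + p (n - k - 1) := by
  have hq : 0 < p (n - k) := hpos _ (by omega) (by omega)
  have hS : 0 ≤ ∑ i ∈ Finset.Icc 1 (n - k - 1), p i := by
    refine Finset.sum_nonneg fun i hi => ?_
    rw [Finset.mem_Icc] at hi
    exact (hpos i hi.1 (by omega)).le
  have : 0 ≤ (1 / ((k : ℝ) + 1)) * ∑ i ∈ Finset.Icc 1 (n - k - 1), p i := by positivity
  linarith

theorem alphaB_lt_one (n : ℕ) (p : ℕ → ℝ)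
    (hpos : ∀ i, 1 ≤ i → i ≤ n → 0 < p i)
    (hmono : ∀ i j, 1 ≤ i → i ≤ j → j ≤ n → p j ≤ p i) (k : ℕ) (hk : k + 1 ≤ n) :
    alphaB n p k < 1 := by
  induction k with
  | zero => simp [alphaB]
  | succ k ih =>
    have hα := ih (by omega)
    have hd : p (n - k) ≤ p (n - k - 1) := hmono _ _ (by omega) (by omega) (by omega)
    have hD := sub_lt_alphaB_denom n p hpos k (by omega)
    have hlt := (div_lt_one (by linarith)).2 hD
    rw [alphaB, mul_div_assoc]
    nlinarith [mul_pos (sub_pos.2 hα) (sub_pos.2 hlt)]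

/-- The breakpoints form a nondecreasing sequence contained in `[0,1)`:
`0 = α_0 ≤ α_1 ≤ … ≤ α_{n−1} < 1`; moreover `α_{k+1} > α_k` whenever
`p (n−k−1) > p (n−k)`. -/
theorem breakpoints_nondecreasing_in_unit_interval
    (n : ℕ) (hn : 2 ≤ n) (p : ℕ → ℝ)
    (hpos : ∀ i, 1 ≤ i → i ≤ n → 0 < p i)
    (hmono : ∀ i j, 1 ≤ i → i ≤ j → j ≤ n → p j ≤ p i)
    (hsum : ∑ i ∈ Finset.Icc 1 n, p i = 1) :
    alphaB n p 0 = 0 ∧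
    (∀ k, k ≤ n - 2 → alphaB n p k ≤ alphaB n p (k + 1)) ∧
    alphaB n p (n - 1) < 1 ∧
    (∀ k, k ≤ n - 2 → p (n - k) < p (n - k - 1) → alphaB n p k < alphaB n p (k + 1)) := by
  have hα : ∀ k, k ≤ n - 2 → 0 < 1 - alphaB n p k := fun k hk =>
    sub_pos.2 (alphaB_lt_one n p hpos hmono k (by omega))
  refine ⟨rfl, fun k hk => ?_, alphaB_lt_one n p hpos hmono _ (by omega), fun k hk hlt => ?_⟩
  · have hd : p (n - k) ≤ p (n - k - 1) := hmono _ _ (by omega) (by omega) (by omega)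
    have hD := sub_lt_alphaB_denom n p hpos k (by omega)
    rw [alphaB, le_add_iff_nonneg_right]
    exact div_nonneg (mul_nonneg (hα k hk).le (sub_nonneg.2 hd)) (by linarith)
  · have hD := sub_lt_alphaB_denom n p hpos k (by omega)
    rw [alphaB, lt_add_iff_pos_right]
    exact div_pos (mul_pos (hα k hk) (sub_pos.2 hlt)) (by linarith)
end

section
/- Special case of a single merged symbol: let α_1 = (p_{n−1} − p_n)/(1 + p_{n−1} − p_n) and let α ∈ [0, α_1). Define l†(i) = −log_D((1−α)p_i) for 1 ≤ i ≤ n−1 and l†(n) = −log_D(α + (1−α)p_n). Then ∑_{i=1}^n D^{−l†(i)} = 1 and for every l : {1,…,n} → ℝ with l_i ≥ 0 and ∑_{i=1}^n D^{−l_i} ≤ 1, one has α·max_i l†(i) + (1−α)·∑_i p_i l†(i) ≤ α·max_i l_i + (1−α)·∑_i p_i l_i. -/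
/-- Gibbs' inequality: among real codelengths satisfying the Kraft inequality, the expected
length with respect to positive weights `w` of total mass one is at least the entropy of `w`. -/
theorem sum_mul_neg_logb_le_sum_mul_of_kraft {ι : Type*} (s : Finset ι) (w l : ι → ℝ) {b : ℝ}
    (hb : 1 < b) (hw : ∀ i ∈ s, 0 < w i) (hw1 : ∑ i ∈ s, w i = 1)
    (hl : ∑ i ∈ s, b ^ (-(l i)) ≤ 1) :
    ∑ i ∈ s, w i * -Real.logb b (w i) ≤ ∑ i ∈ s, w i * l i := by
  have hb0 : 0 < b := by linarith
  have hlog : 0 < Real.log b := Real.log_pos hb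
  have hterm : ∀ i ∈ s, Real.log b * (w i * -Real.logb b (w i) - w i * l i) ≤
      b ^ (-(l i)) - w i := by
    intro i hi
    have hwi := hw i hi
    have hbl : 0 < b ^ (-(l i)) := Real.rpow_pos_of_pos hb0 _
    have h := mul_le_mul_of_nonneg_left (Real.log_le_sub_one_of_pos (div_pos hbl hwi)) hwi.le
    rw [Real.log_div hbl.ne' hwi.ne', Real.log_rpow hb0, mul_sub_one,
      mul_div_cancel₀ _ hwi.ne'] at h
    have hlogb : Real.log b * Real.logb b (w i) = Real.log (w i) := by
      rw [mul_comm, Real.logb, div_mul_cancel₀ _ hlog.ne']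
    linear_combination h - w i * hlogb
  have h := Finset.sum_le_sum hterm
  rw [← Finset.mul_sum, Finset.sum_sub_distrib, Finset.sum_sub_distrib, hw1] at h
  nlinarith


/-- Special case of a single merged symbol: with
`α_1 = (p (n−1) − p n)/(1 + p (n−1) − p n)` and `α ∈ [0, α_1)`, the codelengths
`l†(i) = −log_D((1−α)·p i)` for `1 ≤ i ≤ n−1` and `l†(n) = −log_D(α + (1−α)·p n)`
satisfy the Kraft equality `∑ i, D^(−l†(i)) = 1` and minimize the pay-off
`α·max_i l i + (1−α)·∑ i, p i · l i` over all nonnegative length vectors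
satisfying the Kraft inequality. -/
theorem optimal_codelengths_single_merged_symbol
    (n : ℕ) (hn : 2 ≤ n) (p : ℕ → ℝ)
    (hpos : ∀ i, 1 ≤ i → i ≤ n → 0 < p i)
    (hmono : ∀ i j, 1 ≤ i → i ≤ j → j ≤ n → p j ≤ p i)
    (hsum : ∑ i ∈ Finset.Icc 1 n, p i = 1)
    (D : ℕ) (hD : 2 ≤ D) (α : ℝ)
    (hα0 : 0 ≤ α)
    (hα1 : α < (p (n - 1) - p n) / (1 + p (n - 1) - p n))
    (lopt : ℕ → ℝ)
    (h1 : ∀ i, 1 ≤ i → i ≤ n - 1 → lopt i = - Real.logb D ((1 - α) * p i))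
    (h2 : lopt n = - Real.logb D (α + (1 - α) * p n)) :
    (∑ i ∈ Finset.Icc 1 n, (D : ℝ) ^ (-(lopt i)) = 1) ∧
    (∀ l : ℕ → ℝ, (∀ i, 1 ≤ i → i ≤ n → 0 ≤ l i) →
      (∑ i ∈ Finset.Icc 1 n, (D : ℝ) ^ (-(l i)) ≤ 1) →
      α * (Finset.Icc 1 n).sup' (Finset.nonempty_Icc.mpr (by omega)) lopt +
          (1 - α) * ∑ i ∈ Finset.Icc 1 n, p i * lopt i ≤
        α * (Finset.Icc 1 n).sup' (Finset.nonempty_Icc.mpr (by omega)) l +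
          (1 - α) * ∑ i ∈ Finset.Icc 1 n, p i * l i) := by
  have hpn := hpos n (by omega) le_rfl
  have hd : p n ≤ p (n - 1) := hmono (n - 1) n (by omega) (by omega) le_rfl
  have hd1 : 0 < 1 + p (n - 1) - p n := by linarith
  rw [lt_div_iff₀ hd1] at hα1
  have hα : 0 < 1 - α := by nlinarith
  have hDr : (1 : ℝ) < D := by exact_mod_cast hD
  have hn1 : n ∈ Finset.Icc 1 n := Finset.mem_Icc.mpr ⟨by omega, le_rfl⟩
  let w : ℕ → ℝ := fun i => (1 - α) * p i + if i = n then α else 0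
  have hwpos : ∀ i ∈ Finset.Icc 1 n, 0 < w i := by
    intro i hi
    rw [Finset.mem_Icc] at hi
    have := mul_pos hα (hpos i hi.1 hi.2)
    simp only [w]
    split_ifs <;> linarith
  have hwsum : ∀ f : ℕ → ℝ, ∑ i ∈ Finset.Icc 1 n, w i * f i =
      α * f n + (1 - α) * ∑ i ∈ Finset.Icc 1 n, p i * f i := by
    intro f
    simp only [w, add_mul, ite_mul, zero_mul, Finset.sum_add_distrib, Finset.sum_ite_eq', hn1,
      if_true, mul_assoc, ← Finset.mul_sum]
    ring
  have hw1 : ∑ i ∈ Finset.Icc 1 n, w i = 1 := by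
    have h := hwsum fun _ => 1
    simp only [mul_one, hsum] at h
    rw [h]
    ring
  have hlopt : ∀ i ∈ Finset.Icc 1 n, lopt i = -Real.logb D (w i) := by
    intro i hi
    rw [Finset.mem_Icc] at hi
    by_cases hin : i = n
    · subst hin
      simp [w, h2, add_comm]
    · simp [w, hin, h1 i hi.1 (by omega)]
  refine ⟨?_, fun l _ hl => ?_⟩
  · rw [← hw1]
    refine Finset.sum_congr rfl fun i hi => ?_
    rw [hlopt i hi, neg_neg, Real.rpow_logb (by linarith) hDr.ne' (hwpos i hi)]
  · have hmax : (Finset.Icc 1 n).sup' (Finset.nonempty_Icc.mpr (by omega)) lopt ≤ lopt n := by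
      refine Finset.sup'_le _ _ fun i hi => ?_
      rw [hlopt i hi, hlopt n hn1, neg_le_neg_iff]
      refine Real.logb_le_logb_of_le hDr (hwpos n hn1) ?_
      rcases eq_or_ne i n with rfl | hin
      · rfl
      rw [Finset.mem_Icc] at hi
      have hpi := mul_le_mul_of_nonneg_left
        (hmono i (n - 1) hi.1 (by omega) (by omega)) hα.le
      simp only [w, hin, if_true, if_false]
      linarith
    have hgibbs : ∑ i ∈ Finset.Icc 1 n, w i * lopt i ≤ ∑ i ∈ Finset.Icc 1 n, w i * l i := by
      rw [Finset.sum_congr rfl fun i hi => by rw [hlopt i hi]]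
      exact sum_mul_neg_logb_le_sum_mul_of_kraft _ w l hDr hwpos hw1 hl
    rw [hwsum, hwsum] at hgibbs
    have hle := mul_le_mul_of_nonneg_left hmax hα0
    have hln := mul_le_mul_of_nonneg_left (Finset.le_sup' l hn1) hα0
    linarith
end

section
/- Optimal codelengths for the convex combination of exponential and average codeword length: let t > 0 and α ∈ [0,1], and suppose l† : {1,…,n} → ℝ satisfies the fixed-point equations D^{−l†(i)} = α·ν(i) + (1−α)·p_i for all i, where ν(i) = p_i·D^{t·l†(i)} / ∑_{j=1}^n p_j·D^{t·l†(j)}. Then ∑_{i=1}^n D^{−l†(i)} = 1, and for every l : {1,…,n} → ℝ with l_i ≥ 0 and ∑_{i=1}^n D^{−l_i} ≤ 1, one has (α/t)·log_D(∑_i p_i D^{t·l†(i)}) + (1−α)·∑_i p_i l†(i) ≤ (α/t)·log_D(∑_i p_i D^{t·l_i}) + (1−α)·∑_i p_i l_i. -/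
/-- Jensen's inequality for the logarithm: a weighted mean of exponents is at most the
logarithm of the weighted mean of the powers. -/
theorem sum_mul_le_logb_sum_mul_rpow {ι : Type*} [Fintype ι] {b : ℝ} (hb : 1 < b)
    {w : ι → ℝ} (hw : ∀ i, 0 ≤ w i) (hw1 : ∑ i, w i = 1) (x : ι → ℝ) :
    ∑ i, w i * x i ≤ Real.logb b (∑ i, w i * b ^ x i) := by
  have hb0 : 0 < b := by linarith
  have h := convexOn_exp.map_sum_le (t := Finset.univ) (w := w)
    (p := fun i => Real.log b * x i) (fun i _ => hw i) hw1 (fun i _ => Set.mem_univ _)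
  have hmean : b ^ (∑ i, w i * x i) ≤ ∑ i, w i * b ^ x i := by
    simp only [smul_eq_mul] at h
    simp only [Real.rpow_def_of_pos hb0]
    refine le_trans (le_of_eq ?_) h
    rw [Finset.mul_sum]
    congr 1
    exact Finset.sum_congr rfl fun i _ => by ring
  have hpos : 0 < b ^ (∑ i, w i * x i) := Real.rpow_pos_of_pos hb0 _
  rwa [Real.le_logb_iff_rpow_le hb (hpos.trans_le hmean)]


/-- Optimal codelengths for the convex combination of exponential and
average codeword length: if `t > 0`, `α ∈ [0,1]`, and `l†` satisfies the fixed-point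
equations `D^(−l†(i)) = α·ν(i) + (1−α)·p i` with
`ν(i) = p i · D^(t·l†(i)) / ∑ j, p j · D^(t·l†(j))`, then `∑ i, D^(−l†(i)) = 1` and
`l†` minimizes `(α/t)·log_D(∑ i, p i · D^(t·l i)) + (1−α)·∑ i, p i · l i` over all
nonnegative length vectors satisfying the Kraft inequality. -/
theorem optimal_codelengths_exponential_average
    (n : ℕ) (hn : 2 ≤ n) (p : Fin n → ℝ) (hp : ∀ i, 0 < p i)
    (hsum : ∑ i, p i = 1) (D : ℕ) (hD : 2 ≤ D)
    (t : ℝ) (ht : 0 < t) (α : ℝ) (hα : α ∈ Set.Icc (0 : ℝ) 1)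
    (lopt : Fin n → ℝ)
    (hfix : ∀ i, (D : ℝ) ^ (-(lopt i)) =
      α * (p i * (D : ℝ) ^ (t * lopt i) / ∑ j, p j * (D : ℝ) ^ (t * lopt j)) +
        (1 - α) * p i) :
    (∑ i, (D : ℝ) ^ (-(lopt i)) = 1) ∧
    (∀ l : Fin n → ℝ, (∀ i, 0 ≤ l i) → (∑ i, (D : ℝ) ^ (-(l i)) ≤ 1) →
      (α / t) * Real.logb D (∑ i, p i * (D : ℝ) ^ (t * lopt i)) +
          (1 - α) * ∑ i, p i * lopt i ≤
        (α / t) * Real.logb D (∑ i, p i * (D : ℝ) ^ (t * l i)) +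
          (1 - α) * ∑ i, p i * l i) := by
  obtain ⟨hα0, hα1⟩ := hα
  have hb : (1 : ℝ) < D := by exact_mod_cast hD
  have hb0 : (0 : ℝ) < D := by linarith
  have : Nonempty (Fin n) := ⟨⟨0, by omega⟩⟩
  have hpos : ∀ l : Fin n → ℝ, 0 < ∑ i, p i * (D : ℝ) ^ (t * l i) := fun l =>
    Finset.sum_pos (fun i _ => mul_pos (hp i) (Real.rpow_pos_of_pos hb0 _))
      Finset.univ_nonempty
  set S := ∑ j, p j * (D : ℝ) ^ (t * lopt j) with hS
  have hS0 : 0 < S := hpos lopt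
  set ν : Fin n → ℝ := fun i => p i * (D : ℝ) ^ (t * lopt i) / S with hν
  have hν0 : ∀ i, 0 ≤ ν i := fun i =>
    (div_pos (mul_pos (hp i) (Real.rpow_pos_of_pos hb0 _)) hS0).le
  have hν1 : ∑ i, ν i = 1 := by
    simp only [hν]
    rw [← Finset.sum_div, ← hS, div_self hS0.ne']
  have hq : ∀ i, (D : ℝ) ^ (-(lopt i)) = α * ν i + (1 - α) * p i := hfix
  have hq1 : ∑ i, (D : ℝ) ^ (-(lopt i)) = 1 := by
    simp only [hq]
    rw [Finset.sum_add_distrib, ← Finset.mul_sum, ← Finset.mul_sum, hν1, hsum]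
    ring
  refine ⟨hq1, fun l _ hkraft => ?_⟩
  have hexp : t * ∑ i, ν i * (l i - lopt i) ≤
      Real.logb D (∑ i, p i * (D : ℝ) ^ (t * l i)) - Real.logb D S := by
    rw [← Real.logb_div (hpos l).ne' hS0.ne', Finset.sum_div, Finset.mul_sum]
    have h := sum_mul_le_logb_sum_mul_rpow hb hν0 hν1 (fun i => t * (l i - lopt i))
    convert h using 2 with i
    · ring
    · refine Finset.sum_congr rfl fun i _ => ?_
      simp only [hν]
      rw [mul_sub, Real.rpow_sub hb0]
      have := (Real.rpow_pos_of_pos hb0 (t * lopt i)).ne'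
      field_simp
  have hmean : 0 ≤ ∑ i, (D : ℝ) ^ (-(lopt i)) * (l i - lopt i) := by
    have h := sum_mul_le_logb_sum_mul_rpow hb
      (fun i => (Real.rpow_pos_of_pos hb0 (-(lopt i))).le) hq1 (fun i => lopt i - l i)
    have hpow : ∑ i, (D : ℝ) ^ (-(lopt i)) * (D : ℝ) ^ (lopt i - l i) =
        ∑ i, (D : ℝ) ^ (-(l i)) :=
      Finset.sum_congr rfl fun i _ => by
        rw [← Real.rpow_add hb0]
        congr 1
        ring
    have hlog := Real.logb_nonpos hb
      (Finset.sum_nonneg fun i _ => (Real.rpow_pos_of_pos hb0 (-(l i))).le) hkraft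
    rw [hpow] at h
    have hneg : ∑ i, (D : ℝ) ^ (-(lopt i)) * (l i - lopt i) =
        -∑ i, (D : ℝ) ^ (-(lopt i)) * (lopt i - l i) := by
      rw [← Finset.sum_neg_distrib]
      exact Finset.sum_congr rfl fun i _ => by ring
    linarith
  have hsplit : ∑ i, (D : ℝ) ^ (-(lopt i)) * (l i - lopt i) =
      α * ∑ i, ν i * (l i - lopt i) +
        (1 - α) * (∑ i, p i * l i - ∑ i, p i * lopt i) := by
    rw [← Finset.sum_sub_distrib, Finset.mul_sum, Finset.mul_sum, ← Finset.sum_add_distrib]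
    exact Finset.sum_congr rfl fun i _ => by
      rw [hq i]
      ring
  have hscaled := mul_le_mul_of_nonneg_left hexp (div_nonneg hα0 ht.le)
  rw [← mul_assoc, div_mul_cancel₀ α ht.ne'] at hscaled
  linarith
end

section
/- Explicit solution for α = 1 (exponential pay-off): let t > 0 and define l†(i) = −(1/(1+t))·log_D p_i + log_D( ∑_{j=1}^n p_j^{1/(1+t)} ). Then l†(i) ≥ 0 for all i, ∑_{i=1}^n D^{−l†(i)} = 1, and for every l : {1,…,n} → ℝ with l_i ≥ 0 and ∑_{i=1}^n D^{−l_i} ≤ 1, one has (1/t)·log_D(∑_i p_i D^{t·l†(i)}) ≤ (1/t)·log_D(∑_i p_i D^{t·l_i}). -/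
/-- A weighted form of Hölder's inequality (Radon's inequality). -/
theorem rpow_sum_le_sum_mul_rpow_neg {ι : Type*} (s : Finset ι) {q x : ι → ℝ}
    (hq : ∀ i ∈ s, 0 ≤ q i) (hx : ∀ i ∈ s, 0 < x i) {t : ℝ} (ht : 0 < t) :
    (∑ i ∈ s, q i) ^ (1 + t) ≤
      (∑ i ∈ s, q i ^ (1 + t) * x i ^ (-t)) * (∑ i ∈ s, x i) ^ t := by
  have h1t : 0 < 1 + t := by linarith
  have hconj : (1 + t).HolderConjugate ((1 + t) / t) := by
    rw [Real.holderConjugate_iff]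
    refine ⟨by linarith, ?_⟩
    field_simp
  have holder := Real.inner_le_Lp_mul_Lq_of_nonneg s hconj
    (f := fun i => q i * x i ^ (-t / (1 + t))) (g := fun i => x i ^ (t / (1 + t)))
    (fun i hi => mul_nonneg (hq i hi) (Real.rpow_nonneg (hx i hi).le _))
    (fun i hi => Real.rpow_nonneg (hx i hi).le _)
  have hprod : ∑ i ∈ s, q i * x i ^ (-t / (1 + t)) * x i ^ (t / (1 + t)) = ∑ i ∈ s, q i := by
    refine Finset.sum_congr rfl fun i hi => ?_
    rw [mul_assoc, ← Real.rpow_add (hx i hi), neg_div, neg_add_cancel, Real.rpow_zero, mul_one]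
  have hleft : ∑ i ∈ s, (q i * x i ^ (-t / (1 + t))) ^ (1 + t) =
      ∑ i ∈ s, q i ^ (1 + t) * x i ^ (-t) := by
    refine Finset.sum_congr rfl fun i hi => ?_
    rw [Real.mul_rpow (hq i hi) (Real.rpow_nonneg (hx i hi).le _), ← Real.rpow_mul (hx i hi).le,
      div_mul_cancel₀ _ h1t.ne']
  have hright : ∑ i ∈ s, (x i ^ (t / (1 + t))) ^ ((1 + t) / t) = ∑ i ∈ s, x i := by
    refine Finset.sum_congr rfl fun i hi => ?_
    rw [← Real.rpow_mul (hx i hi).le, div_mul_div_cancel₀ h1t.ne', div_self ht.ne', Real.rpow_one]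
  rw [hprod, hleft, hright] at holder
  have hA : 0 ≤ ∑ i ∈ s, q i ^ (1 + t) * x i ^ (-t) := Finset.sum_nonneg fun i hi =>
    mul_nonneg (Real.rpow_nonneg (hq i hi) _) (Real.rpow_nonneg (hx i hi).le _)
  have hX : 0 ≤ ∑ i ∈ s, x i := Finset.sum_nonneg fun i hi => (hx i hi).le
  calc (∑ i ∈ s, q i) ^ (1 + t)
      ≤ ((∑ i ∈ s, q i ^ (1 + t) * x i ^ (-t)) ^ (1 / (1 + t)) *
          (∑ i ∈ s, x i) ^ (1 / ((1 + t) / t))) ^ (1 + t) :=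
        Real.rpow_le_rpow (Finset.sum_nonneg hq) holder h1t.le
    _ = (∑ i ∈ s, q i ^ (1 + t) * x i ^ (-t)) * (∑ i ∈ s, x i) ^ t := by
        rw [Real.mul_rpow (Real.rpow_nonneg hA _) (Real.rpow_nonneg hX _), ← Real.rpow_mul hA,
          ← Real.rpow_mul hX, one_div_mul_cancel h1t.ne', Real.rpow_one, one_div_div,
          div_mul_cancel₀ _ h1t.ne']

/-- Explicit solution for `α = 1` (exponential pay-off): for `t > 0`
the codelengths `l†(i) = −(1/(1+t))·log_D (p i) + log_D(∑ j, (p j)^(1/(1+t)))` are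
nonnegative, satisfy the Kraft equality `∑ i, D^(−l†(i)) = 1`, and minimize
`(1/t)·log_D(∑ i, p i · D^(t·l i))` over all nonnegative length vectors satisfying
the Kraft inequality. -/
theorem optimal_codelengths_exponential_payoff
    (n : ℕ) (hn : 2 ≤ n) (p : Fin n → ℝ) (hp : ∀ i, 0 < p i)
    (hsum : ∑ i, p i = 1) (D : ℕ) (hD : 2 ≤ D)
    (t : ℝ) (ht : 0 < t)
    (lopt : Fin n → ℝ)
    (hlopt : ∀ i, lopt i = -(1 / (1 + t)) * Real.logb D (p i) +
      Real.logb D (∑ j, p j ^ (1 / (1 + t)))) :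
    (∀ i, 0 ≤ lopt i) ∧
    (∑ i, (D : ℝ) ^ (-(lopt i)) = 1) ∧
    (∀ l : Fin n → ℝ, (∀ i, 0 ≤ l i) → (∑ i, (D : ℝ) ^ (-(l i)) ≤ 1) →
      (1 / t) * Real.logb D (∑ i, p i * (D : ℝ) ^ (t * lopt i)) ≤
        (1 / t) * Real.logb D (∑ i, p i * (D : ℝ) ^ (t * l i))) := by
  have hD1 : (1 : ℝ) < D := by exact_mod_cast hD
  have hD0 : (0 : ℝ) < D := by linarith
  have h1t : 0 < 1 + t := by linarith
  obtain ⟨q, hqdef⟩ : ∃ q : Fin n → ℝ, ∀ i, q i = p i ^ (1 / (1 + t)) := ⟨_, fun _ => rfl⟩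
  have hq : ∀ i, 0 < q i := fun i => hqdef i ▸ Real.rpow_pos_of_pos (hp i) _
  have hpq : ∀ i, p i = q i ^ (1 + t) := fun i => by
    rw [hqdef, ← Real.rpow_mul (hp i).le, one_div_mul_cancel h1t.ne', Real.rpow_one]
  simp only [← hqdef] at hlopt
  set S := ∑ j, q j with hS
  have hqS : ∀ i, q i ≤ S := fun i =>
    Finset.single_le_sum (fun j _ => (hq j).le) (Finset.mem_univ i)
  have hS0 : 0 < S := (hq ⟨0, by omega⟩).trans_le (hqS _)
  have hlog : ∀ i, lopt i = Real.logb D (S / q i) := fun i => by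
    rw [hlopt, hpq, Real.logb_rpow_eq_mul_logb_of_pos (hq i), Real.logb_div hS0.ne' (hq i).ne']
    field_simp
    ring
  have hpow : ∀ i, (D : ℝ) ^ lopt i = S / q i := fun i => by
    rw [hlog, Real.rpow_logb hD0 hD1.ne' (div_pos hS0 (hq i))]
  have hcost : ∑ i, p i * (D : ℝ) ^ (t * lopt i) = S ^ (1 + t) := by
    have hterm : ∀ i, p i * (D : ℝ) ^ (t * lopt i) = q i * S ^ t := fun i => by
      rw [mul_comm t, Real.rpow_mul hD0.le, hpow, hpq, Real.div_rpow hS0.le (hq i).le,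
        Real.rpow_add (hq i), Real.rpow_one]
      have := (Real.rpow_pos_of_pos (hq i) t).ne'
      field_simp
    rw [Finset.sum_congr rfl fun i _ => hterm i, ← Finset.sum_mul, Real.rpow_add hS0,
      Real.rpow_one]
  refine ⟨fun i => ?_, ?_, fun l _ hkraft => ?_⟩
  · rw [hlog]
    exact Real.logb_nonneg hD1 ((one_le_div (hq i)).2 (hqS i))
  · simp only [Real.rpow_neg hD0.le, hpow, inv_div]
    rw [← Finset.sum_div, div_self hS0.ne']
  · have hradon := rpow_sum_le_sum_mul_rpow_neg Finset.univ (q := q)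
      (x := fun i => (D : ℝ) ^ (-(l i))) (fun i _ => (hq i).le)
      (fun i _ => Real.rpow_pos_of_pos hD0 _) ht
    simp only [← hpq, ← Real.rpow_mul hD0.le, neg_mul_neg] at hradon
    rw [hcost]
    refine mul_le_mul_of_nonneg_left (Real.logb_le_logb_of_le hD1 (Real.rpow_pos_of_pos hS0 _) ?_)
      (by positivity)
    simp only [mul_comm t]
    refine hradon.trans (mul_le_of_le_one_right ?_ (Real.rpow_le_one ?_ hkraft ht.le))
    · exact Finset.sum_nonneg fun i _ => mul_nonneg (hp i).le (Real.rpow_nonneg hD0.le _)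
    · exact Finset.sum_nonneg fun i _ => Real.rpow_nonneg hD0.le _
end
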